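/- (Stochastic asynchronous iteration convergence.) Let N be a finite nonempty index set, γ ∈ (0,1), D ≥ 0 and C ≥ 0. On a probability space with a filtration (𝔉_k)_{k≥0}, let (y_k)_{k≥0} with values in ℝ^N, step sizes (β_{n,k})_{k≥0} with values in [0,1], and real error sequences (ε̄_k), (ε_k) all be adapted to (𝔉_k), and let (ω_{n,k})_{k≥0} be such that ω_{n,k} is 𝔉_{k+1}-measurable with E[ω_{n,k} | 𝔉_k] = 0 and E[ω_{n,k}² | 𝔉_k] ≤ C almost surely for each n ∈ N and k ≥ 0. Suppose that almost surely: ‖y_k‖_∞ ≤ D for all k; for each n, Σ_{k≥0} β_{n,k} = ∞, β_{n,k} → 0 and Σ_{k≥0} β_{n,k}² < ∞; ε̄_k → 0 and ε_k → 0; and for all n, k: y_{n,k+1} ≤ (1 − β_{n,k}) y_{n,k} + β_{n,k} γ ‖y_k‖_∞ + β_{n,k} γ ε̄_k + β_{n,k} ω_{n,k} and y_{n,k+1} ≥ (1 − β_{n,k}) y_{n,k} − β_{n,k} γ ‖y_k‖_∞ + β_{n,k} γ ε_k + β_{n,k} ω_{n,k}. Then lim_{k→∞} ‖y_k‖_∞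 = 0 almost surely. -/

import Mathlib

open Finset Filter Topology MeasureTheory

/-- the sup-norm of a vector indexed by a finite nonempty type -/
noncomputable def supNorm {N : Type} [Fintype N] [Nonempty N] (v : N → ℝ) : ℝ :=
  Finset.univ.sup' Finset.univ_nonempty fun n => |v n|

/-- A nonnegative sequence contracted by factors `1 - β k` with `∑ β k = ∞` tends to `0`. -/
theorem tendsto_zero_of_le_one_sub_mul {u β : ℕ → ℝ} {K : ℕ} (hu : ∀ k, 0 ≤ u k)
    (hsum : Tendsto (fun m => ∑ k ∈ range m, β k) atTop atTop)
    (hrec : ∀ k ≥ K, u (k + 1) ≤ (1 - β k) * u k) : Tendsto u atTop (𝓝 0) := by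
  set S : ℕ → ℝ := fun m => ∑ k ∈ range m, β k with hS
  have hmono : ∀ k ≥ K, u k * Real.exp (S k) ≤ u K * Real.exp (S K) := by
    intro k hk
    induction k, hk using Nat.le_induction with
    | base => exact le_rfl
    | succ k hk ih =>
      refine le_trans ?_ ih
      have hSk : S (k + 1) = β k + S k := by rw [hS]; simp [sum_range_succ, add_comm]
      have hexp : (1 - β k) * Real.exp (β k) ≤ 1 := by
        have h := mul_le_mul_of_nonneg_right (Real.one_sub_le_exp_neg (β k)) (Real.exp_pos (β k)).le
        rwa [← Real.exp_add, neg_add_cancel, Real.exp_zero] at h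
      calc u (k + 1) * Real.exp (S (k + 1))
          ≤ (1 - β k) * u k * Real.exp (S (k + 1)) := by gcongr; exact hrec k hk
        _ = ((1 - β k) * Real.exp (β k)) * (u k * Real.exp (S k)) := by
            rw [hSk, Real.exp_add]; ring
        _ ≤ 1 * (u k * Real.exp (S k)) :=
            mul_le_mul_of_nonneg_right hexp (mul_nonneg (hu k) (Real.exp_pos _).le)
        _ = u k * Real.exp (S k) := one_mul _
  have hlim : Tendsto (fun k => u K * Real.exp (S K) * Real.exp (-S k)) atTop (𝓝 0) := by
    simpa using (Real.tendsto_exp_neg_atTop_nhds_zero.comp hsum).const_mul (u K * Real.exp (S K))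
  refine squeeze_zero' (Eventually.of_forall hu) ?_ hlim
  filter_upwards [eventually_ge_atTop K] with k hk
  calc u k = u k * Real.exp (S k) * Real.exp (-S k) := by
        rw [mul_assoc, ← Real.exp_add, add_neg_cancel, Real.exp_zero, mul_one]
    _ ≤ _ := mul_le_mul_of_nonneg_right (hmono k hk) (Real.exp_pos _).le

/-- Averaging with an eventually bounded input and a summable noise gives the same asymptotic
upper bound. -/
theorem eventually_le_of_averaging {x β b w : ℕ → ℝ} {B B' L : ℝ}
    (hβ : ∀ k, β k ≤ 1 ∧ 0 ≤ β k)
    (hsum : Tendsto (fun m => ∑ k ∈ range m, β k) atTop atTop)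
    (hnoise : Tendsto (fun m => ∑ k ∈ range m, β k * w k) atTop (𝓝 L))
    (hrec : ∀ k, x (k + 1) ≤ (1 - β k) * x k + β k * b k + β k * w k)
    (hb : ∀ᶠ k in atTop, b k ≤ B) (hB : B < B') : ∀ᶠ k in atTop, x k ≤ B' := by
  set r : ℕ → ℝ := fun m => ∑ k ∈ range m, β k * w k - L with hr
  have hr0 : Tendsto r atTop (𝓝 0) := by simpa [hr] using hnoise.sub_const L
  set δ := (B' - B) / 3 with hδ
  have hδ0 : 0 < δ := by rw [hδ]; linarith
  have hrδ : ∀ᶠ k in atTop, |r k| < δ := by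
    simpa using hr0.abs.eventually_lt_const (by simpa using hδ0)
  obtain ⟨K, hK⟩ := eventually_atTop.1 (hb.and hrδ)
  have hu : Tendsto (fun k => max (x k - r k - (B + δ)) 0) atTop (𝓝 0) := by
    refine tendsto_zero_of_le_one_sub_mul (K := K) (fun k => le_max_right _ _) hsum ?_
    intro k hk
    obtain ⟨hbk, hrk⟩ := hK k hk
    have hrk' := (abs_lt.1 hrk).1
    obtain ⟨h1, h0⟩ := hβ k
    have hrs : r (k + 1) = r k + β k * w k := by simp only [hr, sum_range_succ]; ring
    have hmax := mul_le_mul_of_nonneg_left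
      (le_max_left (x k - r k - (B + δ)) 0) (sub_nonneg.2 h1)
    refine max_le ?_ (mul_nonneg (sub_nonneg.2 h1) (le_max_right _ _))
    have hbr : β k * (b k - r k) ≤ β k * (B + δ) := by
      apply mul_le_mul_of_nonneg_left _ h0; linarith
    have := hrec k
    rw [hrs]
    nlinarith
  filter_upwards [hu.eventually_lt_const hδ0, hrδ] with k h1 h2
  have := (max_lt_iff.1 h1).1
  have := (abs_lt.1 h2).2
  linarith

theorem abs_le_supNorm {N : Type} [Fintype N] [Nonempty N] (v : N → ℝ) (n : N) :
    |v n| ≤ supNorm v :=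
  le_sup' (fun n => |v n|) (mem_univ n)

theorem supNorm_nonneg {N : Type} [Fintype N] [Nonempty N] (v : N → ℝ) : 0 ≤ supNorm v :=
  (abs_nonneg _).trans (abs_le_supNorm v (Classical.arbitrary N))

/-- Deterministic asynchronous iteration with summable noise converges to `0`. -/
theorem tendsto_supNorm_of_asynchronous {N : Type} [Fintype N] [Nonempty N]
    {γ D : ℝ} (hγ0 : 0 < γ) (hγ1 : γ < 1) {y : ℕ → N → ℝ} {β w : N → ℕ → ℝ} {εup εlow : ℕ → ℝ}
    (hβ : ∀ n k, β n k ∈ Set.Icc (0 : ℝ) 1) (hy : ∀ k, supNorm (y k) ≤ D)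
    (hsum : ∀ n, Tendsto (fun m => ∑ k ∈ range m, β n k) atTop atTop)
    (hnoise : ∀ n, ∃ L, Tendsto (fun m => ∑ k ∈ range m, β n k * w n k) atTop (𝓝 L))
    (hεup : Tendsto εup atTop (𝓝 0)) (hεlow : Tendsto εlow atTop (𝓝 0))
    (hub : ∀ n k, y (k + 1) n ≤ (1 - β n k) * y k n + β n k * γ * supNorm (y k)
      + β n k * γ * εup k + β n k * w n k)
    (hlb : ∀ n k, y (k + 1) n ≥ (1 - β n k) * y k n - β n k * γ * supNorm (y k)
      + β n k * γ * εlow k + β n k * w n k) :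
    Tendsto (fun k => supNorm (y k)) atTop (𝓝 0) := by
  have hcontract : ∀ A, 0 < A → (∀ᶠ k in atTop, supNorm (y k) ≤ A) →
      ∀ᶠ k in atTop, supNorm (y k) ≤ (1 + γ) / 2 * A := by
    intro A hA hyA
    set η := (1 - γ) / 4 * A with hη
    have hη0 : 0 < η := mul_pos (by linarith) hA
    have hBB : γ * A + η < (1 + γ) / 2 * A := by rw [hη]; nlinarith
    have hcoord : ∀ n, ∀ᶠ k in atTop, |y k n| ≤ (1 + γ) / 2 * A := by
      intro n
      obtain ⟨L, hL⟩ := hnoise n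
      have hup : ∀ᶠ k in atTop, y k n ≤ (1 + γ) / 2 * A := by
        refine eventually_le_of_averaging (β := β n) (w := w n) (L := L) (B := γ * A + η)
          (b := fun k => γ * supNorm (y k) + γ * εup k)
          (fun k => ⟨(hβ n k).2, (hβ n k).1⟩) (hsum n) hL (fun k => ?_) ?_ hBB
        · have := hub n k
          linarith
        · filter_upwards [hyA, (hεup.const_mul γ).eventually_lt_const
            (show γ * 0 < η by simpa using hη0)] with k h1 h2
          exact add_le_add (mul_le_mul_of_nonneg_left h1 hγ0.le) h2.le
      have hlow : ∀ᶠ k in atTop, -y k n ≤ (1 + γ) / 2 * A := by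
        refine eventually_le_of_averaging (β := β n) (w := fun k => -w n k) (L := -L)
          (B := γ * A + η) (b := fun k => γ * supNorm (y k) + -(γ * εlow k))
          (fun k => ⟨(hβ n k).2, (hβ n k).1⟩) (hsum n) (by simpa using hL.neg)
          (fun k => ?_) ?_ hBB
        · have := hlb n k
          linarith
        · filter_upwards [hyA, (hεlow.const_mul γ).neg.eventually_lt_const
            (show -(γ * 0) < η by simpa using hη0)] with k h1 h2
          exact add_le_add (mul_le_mul_of_nonneg_left h1 hγ0.le) h2.le
      filter_upwards [hup, hlow] with k h1 h2
      exact abs_le'.2 ⟨h1, h2⟩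
    filter_upwards [eventually_all.2 hcoord] with k hk
    exact sup'_le _ _ fun n _ => hk n
  have hD : 0 ≤ D := (supNorm_nonneg _).trans (hy 0)
  have hpow : ∀ j : ℕ, ∀ᶠ k in atTop, supNorm (y k) ≤ ((1 + γ) / 2) ^ j * (D + 1) := by
    intro j
    induction j with
    | zero => exact Eventually.of_forall fun k => by linarith [hy k]
    | succ j ih =>
      rw [pow_succ', mul_assoc]
      exact hcontract _ (by positivity) ih
  have hlim : Tendsto (fun j : ℕ => ((1 + γ) / 2) ^ j * (D + 1)) atTop (𝓝 0) := by
    simpa using (tendsto_pow_atTop_nhds_zero_of_lt_one (r := (1 + γ) / 2)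
      (by linarith) (by linarith)).mul_const (D + 1)
  refine tendsto_order.2 ⟨fun a ha => Eventually.of_forall fun k =>
    ha.trans_le (supNorm_nonneg _), fun a ha => ?_⟩
  obtain ⟨j, hj⟩ := (hlim.eventually_lt_const ha).exists
  filter_upwards [hpow j] with k hk
  exact hk.trans_lt hj

section Noise

variable {Ω : Type} {m0 : MeasurableSpace Ω} {μ : Measure Ω} [IsProbabilityMeasure μ]
  {𝓕 : Filtration ℕ m0} {C L : ℝ} {b w : ℕ → Ω → ℝ}

/-- A martingale transform with predictable square-summable weights, uniformly bounded, of
martingale differences with bounded conditional variance converges almost surely. -/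
theorem ae_exists_tendsto_sum_mul_of_sum_sq_le (hC : 0 ≤ C)
    (hb_adapted : ∀ k, Measurable[𝓕 k] (b k)) (hb_mem : ∀ k ω, b k ω ∈ Set.Icc (0 : ℝ) 1)
    (hb_sq : ∀ m ω, ∑ k ∈ range m, b k ω ^ 2 ≤ L)
    (hw_meas : ∀ k, Measurable[𝓕 (k + 1)] (w k))
    (hw_sq_int : ∀ k, Integrable (fun ω => w k ω ^ 2) μ)
    (hw_mean : ∀ k, μ[w k | 𝓕 k] =ᵐ[μ] 0)
    (hw_var : ∀ k, ∀ᵐ ω ∂μ, (μ[fun ω' => w k ω' ^ 2 | 𝓕 k]) ω ≤ C) :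
    ∀ᵐ ω ∂μ, ∃ l, Tendsto (fun m => ∑ k ∈ range m, b k ω * w k ω) atTop (𝓝 l) := by
  set M : ℕ → Ω → ℝ := fun m ω => ∑ k ∈ range m, b k ω * w k ω with hM
  have hM_succ : ∀ m, M (m + 1) = M m + b m * w m := fun m => by
    ext ω; simp [hM, sum_range_succ]
  have hw_L2 : ∀ k, MemLp (w k) 2 μ := fun k =>
    (memLp_two_iff_integrable_sq ((hw_meas k).mono (𝓕.le _) le_rfl).aestronglyMeasurable).2
      (hw_sq_int k)
  have hw_int : ∀ k, Integrable (w k) μ := fun k => (hw_L2 k).integrable one_le_two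
  have hb_meas : ∀ k, Measurable (b k) := fun k => (hb_adapted k).mono (𝓕.le _) le_rfl
  have hbw_L2 : ∀ k, MemLp (b k * w k) 2 μ := fun k =>
    (hw_L2 k).of_le ((hb_meas k).mul ((hw_meas k).mono (𝓕.le _) le_rfl)).aestronglyMeasurable
      (Eventually.of_forall fun ω => by
        obtain ⟨h0, h1⟩ := hb_mem k ω
        simpa [abs_of_nonneg h0] using mul_le_of_le_one_left (abs_nonneg (w k ω)) h1)
  have hM_L2 : ∀ m, MemLp (M m) 2 μ := by
    intro m
    induction m with
    | zero => simp [hM]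
    | succ m ih => rw [hM_succ]; exact ih.add (hbw_L2 m)
  have hM_adapted : ∀ m, Measurable[𝓕 m] (M m) := by
    intro m
    induction m with
    | zero => simp [hM]
    | succ m ih =>
      rw [hM_succ]
      exact (ih.mono (𝓕.mono m.le_succ) le_rfl).add
        (((hb_adapted m).mono (𝓕.mono m.le_succ) le_rfl).mul (hw_meas m))
  have horth : ∀ (k : ℕ) (g : Ω → ℝ), Measurable[𝓕 k] g → Integrable (g * w k) μ →
      μ[g * w k | 𝓕 k] =ᵐ[μ] 0 := by
    intro k g hg hgw
    filter_upwards [condExp_mul_of_stronglyMeasurable_left hg.stronglyMeasurable hgw (hw_int k),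
      hw_mean k] with ω h1 h2
    simp [h1, h2]
  have hmart : Martingale M 𝓕 μ := by
    refine martingale_of_condExp_sub_eq_zero_nat (fun m => (hM_adapted m).stronglyMeasurable)
      (fun m => (hM_L2 m).integrable one_le_two) fun m => ?_
    rw [hM_succ, add_sub_cancel_left]
    exact horth m _ (hb_adapted m) ((hbw_L2 m).integrable one_le_two)
  have hb_sq_int : ∀ k, Integrable (fun ω => b k ω ^ 2) μ := fun k =>
    Integrable.of_bound ((hb_meas k).pow_const 2).aestronglyMeasurable 1
      (Eventually.of_forall fun ω => by
        obtain ⟨h0, h1⟩ := hb_mem k ω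
        simpa using (sq_le_one_iff₀ (abs_nonneg _)).2 (abs_le.2 ⟨by linarith, h1⟩))
  have hincr : ∀ k, ∫ ω, (b k ω * w k ω) ^ 2 ∂μ ≤ C * ∫ ω, b k ω ^ 2 ∂μ := by
    intro k
    have hint : Integrable ((fun ω => b k ω ^ 2) * fun ω => w k ω ^ 2) μ := by
      refine (hbw_L2 k).integrable_sq.congr (Eventually.of_forall fun ω => ?_)
      simp [mul_pow]
    have hpull := condExp_mul_of_stronglyMeasurable_left
      (((hb_adapted k).pow_const 2).stronglyMeasurable) hint (hw_sq_int k)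
    calc ∫ ω, (b k ω * w k ω) ^ 2 ∂μ
        = ∫ ω, ((fun ω => b k ω ^ 2) * fun ω => w k ω ^ 2) ω ∂μ := by simp [mul_pow]
      _ = ∫ ω, (μ[(fun ω => b k ω ^ 2) * fun ω => w k ω ^ 2 | 𝓕 k]) ω ∂μ :=
          (integral_condExp (𝓕.le k)).symm
      _ ≤ ∫ ω, C * b k ω ^ 2 ∂μ := by
          refine integral_mono_ae integrable_condExp ((hb_sq_int k).const_mul C) ?_
          filter_upwards [hpull, hw_var k] with ω h1 h2
          rw [h1, Pi.mul_apply, mul_comm C]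
          exact mul_le_mul_of_nonneg_left h2 (sq_nonneg _)
      _ = C * ∫ ω, b k ω ^ 2 ∂μ := integral_const_mul _ _
  have hvar : ∀ m, ∫ ω, M m ω ^ 2 ∂μ ≤ C * ∫ ω, ∑ k ∈ range m, b k ω ^ 2 ∂μ := by
    intro m
    induction m with
    | zero => simp [hM]
    | succ m ih =>
      have hcross_int : Integrable (M m * b m * w m) μ := by
        rw [mul_assoc]; exact (hM_L2 m).integrable_mul (hbw_L2 m)
      have hcross : ∫ ω, (M m * b m * w m) ω ∂μ = 0 := by
        rw [← integral_condExp (𝓕.le m), integral_congr_ae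
          (horth m _ ((hM_adapted m).mul (hb_adapted m)) hcross_int)]
        simp
      have hsplit : ∫ ω, M (m + 1) ω ^ 2 ∂μ
          = ∫ ω, M m ω ^ 2 ∂μ + 2 * ∫ ω, (M m * b m * w m) ω ∂μ
            + ∫ ω, (b m ω * w m ω) ^ 2 ∂μ := by
        have hadd := integral_add ((hM_L2 m).integrable_sq.add (hcross_int.const_mul 2))
          (hbw_L2 m).integrable_sq
        rw [← integral_const_mul, ← integral_add (hM_L2 m).integrable_sq (hcross_int.const_mul 2)]
        refine Eq.trans (integral_congr_ae (Eventually.of_forall fun ω => ?_)) hadd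
        simp only [hM_succ, Pi.add_apply, Pi.mul_apply]
        ring
      have hsum : ∫ ω, ∑ k ∈ range (m + 1), b k ω ^ 2 ∂μ
          = ∫ ω, ∑ k ∈ range m, b k ω ^ 2 ∂μ + ∫ ω, b m ω ^ 2 ∂μ := by
        simp only [sum_range_succ]
        exact integral_add (integrable_finsetSum _ fun k _ => hb_sq_int k) (hb_sq_int m)
      rw [hsplit, hcross, hsum]
      linarith [hincr m]
  have hbound : ∀ m, ∫ ω, ‖M m ω‖ ∂μ ≤ 1 + C * L := by
    intro m
    have hL : ∫ ω, ∑ k ∈ range m, b k ω ^ 2 ∂μ ≤ L := by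
      simpa using integral_mono (integrable_finsetSum _ fun k _ => hb_sq_int k)
        (integrable_const (μ := μ) L) (hb_sq m)
    calc ∫ ω, ‖M m ω‖ ∂μ ≤ ∫ ω, (1 + M m ω ^ 2) ∂μ := by
          refine integral_mono ((hM_L2 m).integrable one_le_two).norm
            ((integrable_const 1).add (hM_L2 m).integrable_sq) fun ω => ?_
          rw [Real.norm_eq_abs]
          nlinarith [sq_abs (M m ω), sq_nonneg (|M m ω| - 1), abs_nonneg (M m ω)]
      _ = 1 + ∫ ω, M m ω ^ 2 ∂μ := by
          rw [integral_add (integrable_const 1) (hM_L2 m).integrable_sq]; simp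
      _ ≤ 1 + C * L := by
          linarith [hvar m, mul_le_mul_of_nonneg_left hL hC]
  refine hmart.submartingale.exists_ae_tendsto_of_bdd (R := (1 + C * L).toNNReal) fun m => ?_
  rw [eLpNorm_one_eq_lintegral_enorm,
    ← ofReal_integral_norm_eq_lintegral_enorm ((hM_L2 m).integrable one_le_two)]
  exact ENNReal.ofReal_le_ofReal (hbound m)

/-- Martingale transforms of martingale differences with bounded conditional variance converge
almost surely when the predictable weights are almost surely square-summable. -/
theorem ae_exists_tendsto_sum_mul_of_summable_sq (hC : 0 ≤ C)
    (hb_adapted : ∀ k, Measurable[𝓕 k] (b k)) (hb_mem : ∀ k ω, b k ω ∈ Set.Icc (0 : ℝ) 1)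
    (hb_sq : ∀ᵐ ω ∂μ, Summable fun k => b k ω ^ 2)
    (hw_meas : ∀ k, Measurable[𝓕 (k + 1)] (w k))
    (hw_sq_int : ∀ k, Integrable (fun ω => w k ω ^ 2) μ)
    (hw_mean : ∀ k, μ[w k | 𝓕 k] =ᵐ[μ] 0)
    (hw_var : ∀ k, ∀ᵐ ω ∂μ, (μ[fun ω' => w k ω' ^ 2 | 𝓕 k]) ω ≤ C) :
    ∀ᵐ ω ∂μ, ∃ l, Tendsto (fun m => ∑ k ∈ range m, b k ω * w k ω) atTop (𝓝 l) := by
  classical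
  set A : ℕ → ℕ → Set Ω := fun K k => {ω | ∑ i ∈ range (k + 1), b i ω ^ 2 ≤ K} with hA
  have hA_meas : ∀ K k, MeasurableSet[𝓕 k] (A K k) := fun K k =>
    measurableSet_le (Finset.measurable_fun_sum _ fun i hi =>
      ((hb_adapted i).mono (𝓕.mono (Nat.lt_succ_iff.1 (mem_range.1 hi))) le_rfl).pow_const 2)
      measurable_const
  have htrunc : ∀ K : ℕ, ∀ᵐ ω ∂μ, ∃ l,
      Tendsto (fun m => ∑ k ∈ range m, (A K k).indicator (b k) ω * w k ω) atTop (𝓝 l) := by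
    intro K
    refine ae_exists_tendsto_sum_mul_of_sum_sq_le (𝓕 := 𝓕) (L := K) hC
      (fun k => (hb_adapted k).indicator (hA_meas K k)) (fun k ω => ?_) (fun m ω => ?_)
      hw_meas hw_sq_int hw_mean hw_var
    · by_cases h : ω ∈ A K k
      · simpa [h] using hb_mem k ω
      · simp [h]
    · induction m with
      | zero => simp
      | succ m ih =>
        by_cases h : ω ∈ A K m
        · refine le_trans (sum_le_sum fun k _ => ?_) h
          by_cases hk : ω ∈ A K k
          · simp [hk]
          · simpa [hk] using sq_nonneg (b k ω)
        · simpa [sum_range_succ, h] using ih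
  filter_upwards [ae_all_iff.2 htrunc, hb_sq] with ω hω hsq
  obtain ⟨K, hK⟩ := exists_nat_ge (∑' k, b k ω ^ 2)
  have hmem : ∀ k, ω ∈ A K k := fun k =>
    (hsq.sum_le_tsum _ fun i _ => sq_nonneg (b i ω)).trans hK
  simpa [hmem] using hω K

end Noise

/-- Stochastic asynchronous iteration convergence (Theorem of Appendix B,
martingale-difference case): under the sandwich inequalities with vanishing errors and
square-summable step sizes, `‖y_k‖_∞ → 0` almost surely. -/
theorem async_iteration_stochastic {N : Type} [Fintype N] [Nonempty N]
    {Ω : Type} {m0 : MeasurableSpace Ω} (μ : Measure Ω) [IsProbabilityMeasure μ]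
    (𝓕 : Filtration ℕ m0)
    (γ D C : ℝ) (hγ0 : 0 < γ) (hγ1 : γ < 1) (hD : 0 ≤ D) (hC : 0 ≤ C)
    (y : ℕ → Ω → N → ℝ) (β : N → ℕ → Ω → ℝ) (εup εlow : ℕ → Ω → ℝ) (w : N → ℕ → Ω → ℝ)
    -- adaptedness of the processes
    (hy_adapted : ∀ k, Measurable[𝓕 k] (y k))
    (hβ_adapted : ∀ n k, Measurable[𝓕 k] (β n k))
    (hεup_adapted : ∀ k, Measurable[𝓕 k] (εup k))
    (hεlow_adapted : ∀ k, Measurable[𝓕 k] (εlow k))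
    -- `ω_{n,k}` is an `𝓕_{k+1}`-measurable martingale difference with bounded variance
    (hw_meas : ∀ n k, Measurable[𝓕 (k+1)] (w n k))
    (hw_int : ∀ n k, Integrable (w n k) μ)
    (hw_sq_int : ∀ n k, Integrable (fun ω => (w n k ω) ^ 2) μ)
    (hw_mean : ∀ n k, μ[w n k | 𝓕 k] =ᵐ[μ] 0)
    (hw_var : ∀ n k, ∀ᵐ ω ∂μ, (μ[fun ω' => (w n k ω') ^ 2 | 𝓕 k]) ω ≤ C)
    -- step sizes and boundedness
    (hβmem : ∀ n k ω, β n k ω ∈ Set.Icc (0:ℝ) 1)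
    (hybdd : ∀ᵐ ω ∂μ, ∀ k, supNorm (y k ω) ≤ D)
    (hβsum : ∀ᵐ ω ∂μ, ∀ n, Tendsto (fun m => ∑ k ∈ Finset.range m, β n k ω) atTop atTop)
    (hβ0 : ∀ᵐ ω ∂μ, ∀ n, Tendsto (fun k => β n k ω) atTop (𝓝 0))
    (hβsq : ∀ᵐ ω ∂μ, ∀ n, Summable fun k => (β n k ω) ^ 2)
    -- vanishing error terms
    (hεup0 : ∀ᵐ ω ∂μ, Tendsto (fun k => εup k ω) atTop (𝓝 0))
    (hεlow0 : ∀ᵐ ω ∂μ, Tendsto (fun k => εlow k ω) atTop (𝓝 0))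
    -- the sandwich inequalities
    (hub : ∀ᵐ ω ∂μ, ∀ n k, y (k+1) ω n
      ≤ (1 - β n k ω) * y k ω n + β n k ω * γ * supNorm (y k ω)
        + β n k ω * γ * εup k ω + β n k ω * w n k ω)
    (hlb : ∀ᵐ ω ∂μ, ∀ n k, y (k+1) ω n
      ≥ (1 - β n k ω) * y k ω n - β n k ω * γ * supNorm (y k ω)
        + β n k ω * γ * εlow k ω + β n k ω * w n k ω) :
    ∀ᵐ ω ∂μ, Tendsto (fun k => supNorm (y k ω)) atTop (𝓝 0) := by
  have hnoise : ∀ᵐ ω ∂μ, ∀ n, ∃ l,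
      Tendsto (fun m => ∑ k ∈ range m, β n k ω * w n k ω) atTop (𝓝 l) :=
    ae_all_iff.2 fun n => ae_exists_tendsto_sum_mul_of_summable_sq hC (hβ_adapted n) (hβmem n)
      (hβsq.mono fun ω h => h n) (hw_meas n) (hw_sq_int n) (hw_mean n) (hw_var n)
  filter_upwards [hnoise, hybdd, hβsum, hεup0, hεlow0, hub, hlb]
    with ω hnoise hybdd hβsum hεup0 hεlow0 hub hlb
  exact tendsto_supNorm_of_asynchronous hγ0 hγ1 (fun n k => hβmem n k ω) hybdd hβsum hnoise
    hεup0 hεlow0 hub hlb
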